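/- arXiv:2601.08772 — 4 statements merged into one kernel-verified Lean document; each statement's English description precedes it below -/
import Mathlib

section
/- Let n ≥ 1, let P be an n-qubit Pauli word with P ≠ 1 (i.e. not the identity word), and let θ ∈ ℝ. Then: (a) for every finite family of n-qubit Clifford unitaries C_i and real numbers a_i such that Σ_i a_i · C_i ρ C_i† = R_P(θ) ρ R_P(θ)† for all ρ ∈ M_{2ⁿ}(ℂ), one has Σ_i |a_i| ≥ |sin θ| + |cos θ|; and (b) this bound is attained: the four unitaries R_P(kπ/2), k = 0,1,2,3, are Clifford unitaries and R_P(θ) ρ R_P(θ)† = Σ_{k=0}^{3} a_k(θ) R_P(kπ/2) ρ R_P(kπ/2)† for all ρ, with Σ_k |a_k(θ)| = |sin θ| + |cos θ|. Hence the minimal ℓ1-norm over all real linear decompositions of the rotation channel R_P(θ) into Clifford conjugation channels equals |sin θ| + |cos θ|. -/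
open Matrix

/-- The rotation gate `R_P(θ) = cos(θ/2)·1 − i·sin(θ/2)·P`. -/
noncomputable def rotGate {ι : Type*} [Fintype ι] [DecidableEq ι]
    (P : Matrix ι ι ℂ) (θ : ℝ) : Matrix ι ι ℂ :=
  (Real.cos (θ / 2) : ℂ) • (1 : Matrix ι ι ℂ) -
    (Complex.I * (Real.sin (θ / 2) : ℂ)) • P

/-- The quasiprobability coefficients `a_k(θ)` of the optimal Clifford
decomposition of a Pauli rotation. -/
noncomputable def qpCoeff (θ : ℝ) : Fin 4 → ℝ :=
  ![|Real.cos θ| / (2 * (|Real.sin θ| + |Real.cos θ|)) + Real.cos θ / 2,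
    |Real.sin θ| / (2 * (|Real.sin θ| + |Real.cos θ|)) + Real.sin θ / 2,
    |Real.cos θ| / (2 * (|Real.sin θ| + |Real.cos θ|)) - Real.cos θ / 2,
    |Real.sin θ| / (2 * (|Real.sin θ| + |Real.cos θ|)) - Real.sin θ / 2]

/-- The four one-qubit matrices `σ₀ = I, σ₁ = X, σ₂ = Y, σ₃ = Z`. -/
noncomputable def pauliMat : Fin 4 → Matrix (Fin 2) (Fin 2) ℂ :=
  ![1, !![0, 1; 1, 0], !![0, -Complex.I; Complex.I, 0], !![1, 0; 0, -1]]

/-- The `n`-qubit Pauli word `σ_{f(1)} ⊗ ⋯ ⊗ σ_{f(n)}`, realized as a matrix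
indexed by bit strings. -/
noncomputable def pauliWord (n : ℕ) (f : Fin n → Fin 4) :
    Matrix (Fin n → Fin 2) (Fin n → Fin 2) ℂ :=
  Matrix.of fun x y => ∏ i, pauliMat (f i) (x i) (y i)

/-- The `n`-qubit Pauli group: matrices `i^a · W` for a Pauli word `W`. -/
def pauliGroup (n : ℕ) : Set (Matrix (Fin n → Fin 2) (Fin n → Fin 2) ℂ) :=
  {M | ∃ (a : Fin 4) (f : Fin n → Fin 4), M = Complex.I ^ (a : ℕ) • pauliWord n f}

/-- An `n`-qubit Clifford unitary: a unitary normalizing the Pauli group. -/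
def IsClifford (n : ℕ) (C : Matrix (Fin n → Fin 2) (Fin n → Fin 2) ℂ) : Prop :=
  C ∈ Matrix.unitaryGroup (Fin n → Fin 2) ℂ ∧
    ∀ Q ∈ pauliGroup n, C * Q * Cᴴ ∈ pauliGroup n

/-- The iterated Kronecker product of a family of square matrices. -/
def piKronecker {n : ℕ} {κ : Type*} (A : Fin n → Matrix κ κ ℂ) :
    Matrix (Fin n → κ) (Fin n → κ) ℂ :=
  Matrix.of fun x y => ∏ i, A i (x i) (y i)

theorem pauliWord_eq_piKronecker (n : ℕ) (f : Fin n → Fin 4) :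
    pauliWord n f = piKronecker fun i => pauliMat (f i) := rfl

theorem piKronecker_mul {n : ℕ} {κ : Type*} [Fintype κ] (A B : Fin n → Matrix κ κ ℂ) :
    piKronecker A * piKronecker B = piKronecker fun i => A i * B i := by
  ext x y
  simp only [piKronecker, Matrix.mul_apply, Matrix.of_apply, ← Finset.prod_mul_distrib]
  rw [Finset.prod_univ_sum, Fintype.piFinset_univ]

theorem piKronecker_smul {n : ℕ} {κ : Type*} (c : Fin n → ℂ) (A : Fin n → Matrix κ κ ℂ) :
    (piKronecker fun i => c i • A i) = (∏ i, c i) • piKronecker A := by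
  ext x y
  simp [piKronecker, Finset.prod_mul_distrib]

theorem piKronecker_one {n : ℕ} {κ : Type*} [DecidableEq κ] :
    (piKronecker fun _ : Fin n => (1 : Matrix κ κ ℂ)) = 1 := by
  ext x y
  by_cases h : x = y
  · subst h
    simp [piKronecker]
  · obtain ⟨i, hi⟩ := Function.ne_iff.mp h
    simp only [piKronecker, Matrix.of_apply, Matrix.one_apply_ne h]
    exact Finset.prod_eq_zero (Finset.mem_univ i) (Matrix.one_apply_ne hi)

theorem piKronecker_conjTranspose {n : ℕ} {κ : Type*} (A : Fin n → Matrix κ κ ℂ) :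
    (piKronecker A)ᴴ = piKronecker fun i => (A i)ᴴ := by
  ext x y
  simp [piKronecker, Matrix.conjTranspose_apply]

theorem trace_piKronecker {n : ℕ} {κ : Type*} [Fintype κ] (A : Fin n → Matrix κ κ ℂ) :
    (piKronecker A).trace = ∏ i, (A i).trace := by
  simp only [piKronecker, Matrix.trace, Matrix.diag_apply, Matrix.of_apply]
  rw [Finset.prod_univ_sum, Fintype.piFinset_univ]

theorem pauliMat_conjTranspose (a : Fin 4) : (pauliMat a)ᴴ = pauliMat a := by
  fin_cases a <;> ext i j <;> fin_cases i <;> fin_cases j <;>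
    simp [pauliMat, Matrix.conjTranspose_apply]

theorem pauliMat_mul_self (a : Fin 4) : pauliMat a * pauliMat a = 1 := by
  fin_cases a <;> ext i j <;> fin_cases i <;> fin_cases j <;>
    simp [pauliMat, Matrix.mul_apply]

theorem pauliMat_mul (a b : Fin 4) :
    ∃ (k : ℕ) (d : Fin 4), pauliMat a * pauliMat b = Complex.I ^ k • pauliMat d := by
  refine ⟨(![![0, 0, 0, 0], ![0, 0, 1, 3], ![0, 3, 0, 1], ![0, 1, 3, 0]] :
      Fin 4 → Fin 4 → ℕ) a b,
    (![![0, 1, 2, 3], ![1, 0, 3, 2], ![2, 3, 0, 1], ![3, 2, 1, 0]] :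
      Fin 4 → Fin 4 → Fin 4) a b, ?_⟩
  fin_cases a <;> fin_cases b <;> ext i j <;> fin_cases i <;> fin_cases j <;>
    simp [pauliMat, Matrix.mul_apply, Complex.I_pow_three]

theorem trace_pauliMat_mul (a b : Fin 4) :
    (pauliMat a * pauliMat b).trace = if a = b then 2 else 0 := by
  fin_cases a <;> fin_cases b <;>
    simp [pauliMat, Matrix.trace_fin_two] <;> norm_num

theorem pauliMat_commute_or_anticommute (a b : Fin 4) :
    ∃ e : ℂ, (e = 1 ∨ e = -1) ∧
      pauliMat a * pauliMat b = e • (pauliMat b * pauliMat a) := by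
  refine ⟨(![![1, 1, 1, 1], ![1, 1, -1, -1], ![1, -1, 1, -1], ![1, -1, -1, 1]] :
    Fin 4 → Fin 4 → ℂ) a b, ?_, ?_⟩
  · fin_cases a <;> fin_cases b <;> simp
  · fin_cases a <;> fin_cases b <;> ext i j <;> fin_cases i <;> fin_cases j <;>
      simp [pauliMat, Matrix.mul_apply]

theorem exists_pauliMat_anticommute {a : Fin 4} (ha : a ≠ 0) :
    ∃ b, pauliMat a * pauliMat b = (-1 : ℂ) • (pauliMat b * pauliMat a) := by
  refine ⟨(![0, 2, 3, 1] : Fin 4 → Fin 4) a, ?_⟩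
  fin_cases a
  · exact absurd rfl ha
  all_goals
    ext i j; fin_cases i <;> fin_cases j <;> simp [pauliMat, Matrix.mul_apply]

theorem pauliWord_zero (n : ℕ) : pauliWord n 0 = 1 :=
  piKronecker_one

theorem pauliWord_conjTranspose (n : ℕ) (f : Fin n → Fin 4) :
    (pauliWord n f)ᴴ = pauliWord n f := by
  simp only [pauliWord_eq_piKronecker, piKronecker_conjTranspose, pauliMat_conjTranspose]

theorem pauliWord_mul_self (n : ℕ) (f : Fin n → Fin 4) :
    pauliWord n f * pauliWord n f = 1 := by
  simp only [pauliWord_eq_piKronecker, piKronecker_mul, pauliMat_mul_self, piKronecker_one]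

theorem trace_pauliWord_mul (n : ℕ) (f g : Fin n → Fin 4) :
    (pauliWord n f * pauliWord n g).trace = if f = g then 2 ^ n else 0 := by
  simp only [pauliWord_eq_piKronecker, piKronecker_mul, trace_piKronecker, trace_pauliMat_mul]
  by_cases h : f = g
  · simp [h]
  · obtain ⟨i, hi⟩ := Function.ne_iff.mp h
    rw [if_neg h]
    exact Finset.prod_eq_zero (Finset.mem_univ i) (if_neg hi)

theorem pauliWord_commute_or_anticommute (n : ℕ) (f g : Fin n → Fin 4) :
    pauliWord n f * pauliWord n g = pauliWord n g * pauliWord n f ∨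
      pauliWord n f * pauliWord n g = -(pauliWord n g * pauliWord n f) := by
  choose e he hmul using fun i => pauliMat_commute_or_anticommute (f i) (g i)
  have hprod : ∏ i, e i = 1 ∨ ∏ i, e i = -1 := by
    refine Finset.prod_induction e (fun z => z = 1 ∨ z = -1) ?_ (Or.inl rfl) fun i _ => he i
    rintro a b (rfl | rfl) (rfl | rfl) <;> simp
  simp only [pauliWord_eq_piKronecker, piKronecker_mul, hmul, piKronecker_smul]
  rcases hprod with h | h <;> simp [h]

theorem exists_pauliWord_anticommute {n : ℕ} {f : Fin n → Fin 4} (hf : f ≠ 0) :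
    ∃ g, pauliWord n f * pauliWord n g = -(pauliWord n g * pauliWord n f) := by
  obtain ⟨i, hi⟩ := Function.ne_iff.mp hf
  obtain ⟨b, hb⟩ := exists_pauliMat_anticommute hi
  refine ⟨Pi.single i b, ?_⟩
  have hmul (j : Fin n) : pauliMat (f j) * pauliMat ((Pi.single i b : Fin n → Fin 4) j) =
      (if j = i then (-1 : ℂ) else 1) •
        (pauliMat ((Pi.single i b : Fin n → Fin 4) j) * pauliMat (f j)) := by
    by_cases h : j = i
    · subst h
      simpa using hb
    · simp [h, pauliMat]
  simp only [pauliWord_eq_piKronecker, piKronecker_mul, hmul, piKronecker_smul]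
  simp

theorem I_pow_smul_pauliWord_mem (n k : ℕ) (f : Fin n → Fin 4) :
    Complex.I ^ k • pauliWord n f ∈ pauliGroup n :=
  ⟨⟨k % 4, Nat.mod_lt _ (by norm_num)⟩, f, by rw [Complex.I_pow_eq_pow_mod]⟩

theorem I_pow_smul_mem_pauliGroup {n : ℕ} (k : ℕ) {M : Matrix (Fin n → Fin 2) (Fin n → Fin 2) ℂ}
    (hM : M ∈ pauliGroup n) : Complex.I ^ k • M ∈ pauliGroup n := by
  obtain ⟨a, f, rfl⟩ := hM
  rw [smul_smul, ← pow_add]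
  exact I_pow_smul_pauliWord_mem n _ f

theorem pauliWord_mem (n : ℕ) (f : Fin n → Fin 4) : pauliWord n f ∈ pauliGroup n := by
  simpa using I_pow_smul_pauliWord_mem n 0 f

theorem pauliWord_mul_mem (n : ℕ) (f g : Fin n → Fin 4) :
    pauliWord n f * pauliWord n g ∈ pauliGroup n := by
  choose k d h using fun i => pauliMat_mul (f i) (g i)
  simp only [pauliWord_eq_piKronecker, piKronecker_mul, h, piKronecker_smul,
    Finset.prod_pow_eq_pow_sum]
  exact I_pow_smul_pauliWord_mem n _ d

/-- The overlaps of a Pauli group element with two distinct Pauli words have total modulus at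
most `2 ^ n`. -/
theorem norm_trace_add_norm_trace_le {n : ℕ} {g h : Fin n → Fin 4} (hgh : g ≠ h)
    {M : Matrix (Fin n → Fin 2) (Fin n → Fin 2) ℂ} (hM : M ∈ pauliGroup n) :
    ‖(pauliWord n g * M).trace‖ + ‖(pauliWord n h * M).trace‖ ≤ 2 ^ n := by
  obtain ⟨a, d, rfl⟩ := hM
  simp only [Matrix.mul_smul, Matrix.trace_smul, trace_pauliWord_mul, smul_eq_mul, norm_mul,
    norm_pow, Complex.norm_I, one_pow, one_mul]
  by_cases hg : g = d
  · have hd : h ≠ d := fun e => hgh (hg.trans e.symm)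
    simp [hg, hd]
  · by_cases hd : h = d <;> simp [hg, hd]

section Rotation

variable {ι : Type*} [Fintype ι] [DecidableEq ι] {P : Matrix ι ι ℂ}

theorem rotGate_conj (hP : Pᴴ = P) (θ : ℝ) (ρ : Matrix ι ι ℂ) :
    rotGate P θ * ρ * (rotGate P θ)ᴴ =
      ((1 + Real.cos θ) / 2 : ℂ) • ρ + ((1 - Real.cos θ) / 2 : ℂ) • (P * ρ * P) +
        (Complex.I * Real.sin θ / 2) • (ρ * P - P * ρ) := by
  have hc : (Real.cos θ : ℂ) = 2 * Real.cos (θ / 2) ^ 2 - 1 := by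
    rw [← mul_div_cancel₀ θ (two_ne_zero' ℝ), mul_div_assoc, Real.cos_two_mul]
    push_cast
    ring_nf
  have hs : (Real.sin θ : ℂ) = 2 * Real.sin (θ / 2) * Real.cos (θ / 2) := by
    rw [← mul_div_cancel₀ θ (two_ne_zero' ℝ), mul_div_assoc, Real.sin_two_mul]
    push_cast
    ring_nf
  have hsc : (Real.sin (θ / 2) : ℂ) ^ 2 = 1 - (Real.cos (θ / 2) : ℂ) ^ 2 := by
    exact_mod_cast Real.sin_sq (θ / 2)
  have hadj : (rotGate P θ)ᴴ = (Real.cos (θ / 2) : ℂ) • (1 : Matrix ι ι ℂ) +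
      (Complex.I * (Real.sin (θ / 2) : ℂ)) • P := by
    simp only [rotGate, conjTranspose_sub, conjTranspose_smul, conjTranspose_one, hP, star_mul',
      Complex.star_def, Complex.conj_I, Complex.conj_ofReal, neg_mul, neg_smul, sub_neg_eq_add]
  rw [hadj, hc, hs, rotGate]
  generalize (Real.cos (θ / 2) : ℂ) = c at *
  generalize (Real.sin (θ / 2) : ℂ) = s at *
  simp only [sub_mul, mul_add, Matrix.smul_mul, Matrix.mul_smul, Matrix.one_mul, Matrix.mul_one,
    smul_sub, smul_smul]
  match_scalars
  · ring
  · ring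
  · ring
  · linear_combination (-s ^ 2) * Complex.I_sq + hsc

theorem rotGate_conj_of_commute (hP : Pᴴ = P) (hP2 : P * P = 1) (θ : ℝ) {Q : Matrix ι ι ℂ}
    (hPQ : P * Q = Q * P) : rotGate P θ * Q * (rotGate P θ)ᴴ = Q := by
  rw [rotGate_conj hP, hPQ, Matrix.mul_assoc, hP2, Matrix.mul_one, sub_self, smul_zero, add_zero,
    ← add_smul]
  ring_nf
  exact one_smul _ Q

theorem rotGate_conj_of_anticommute (hP : Pᴴ = P) (hP2 : P * P = 1) (θ : ℝ) {Q : Matrix ι ι ℂ}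
    (hPQ : P * Q = -(Q * P)) :
    rotGate P θ * Q * (rotGate P θ)ᴴ =
      (Real.cos θ : ℂ) • Q - (Complex.I * Real.sin θ) • (P * Q) := by
  rw [rotGate_conj hP, ← neg_eq_iff_eq_neg.mpr hPQ, hPQ, Matrix.neg_mul, Matrix.mul_assoc, hP2,
    Matrix.mul_one]
  module

theorem rotGate_mem_unitaryGroup (hP : Pᴴ = P) (hP2 : P * P = 1) (θ : ℝ) :
    rotGate P θ ∈ Matrix.unitaryGroup ι ℂ := by
  rw [Matrix.mem_unitaryGroup_iff, Matrix.star_eq_conjTranspose]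
  simpa using rotGate_conj_of_commute hP hP2 θ (Q := 1) (by simp)

end Rotation

theorem cos_nat_mul_pi_div_two (k : Fin 4) :
    Real.cos ((k : ℕ) * Real.pi / 2) = (![1, 0, -1, 0] : Fin 4 → ℝ) k := by
  fin_cases k
  · simp
  · simp
  · simp
  · have : (3 : ℝ) * Real.pi / 2 = Real.pi / 2 + Real.pi := by ring
    simp [this, Real.cos_add_pi]

theorem sin_nat_mul_pi_div_two (k : Fin 4) :
    Real.sin ((k : ℕ) * Real.pi / 2) = (![0, 1, 0, -1] : Fin 4 → ℝ) k := by
  fin_cases k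
  · simp
  · simp
  · simp
  · have : (3 : ℝ) * Real.pi / 2 = Real.pi / 2 + Real.pi := by ring
    simp [this, Real.sin_add_pi]

theorem isClifford_rotGate (n : ℕ) (f : Fin n → Fin 4) (k : Fin 4) :
    IsClifford n (rotGate (pauliWord n f) ((k : ℕ) * Real.pi / 2)) := by
  have hP := pauliWord_conjTranspose n f
  have hP2 := pauliWord_mul_self n f
  refine ⟨rotGate_mem_unitaryGroup hP hP2 _, ?_⟩
  rintro _ ⟨a, g, rfl⟩
  rw [Matrix.mul_smul, Matrix.smul_mul]
  refine I_pow_smul_mem_pauliGroup _ ?_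
  rcases pauliWord_commute_or_anticommute n f g with h | h
  · rw [rotGate_conj_of_commute hP hP2 _ h]
    exact pauliWord_mem n g
  · rw [rotGate_conj_of_anticommute hP hP2 _ h, cos_nat_mul_pi_div_two, sin_nat_mul_pi_div_two]
    have hfg := pauliWord_mul_mem n f g
    fin_cases k
    · simpa using pauliWord_mem n g
    · simpa [Complex.I_pow_three] using I_pow_smul_mem_pauliGroup 3 hfg
    · simpa using I_pow_smul_mem_pauliGroup 2 (pauliWord_mem n g)
    · simpa using I_pow_smul_mem_pauliGroup 1 hfg

theorem one_le_abs_sin_add_abs_cos (θ : ℝ) : 1 ≤ |Real.sin θ| + |Real.cos θ| := by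
  nlinarith [Real.sin_sq_add_cos_sq θ, sq_abs (Real.sin θ), sq_abs (Real.cos θ),
    abs_nonneg (Real.sin θ), abs_nonneg (Real.cos θ), Real.abs_sin_le_one θ,
    Real.abs_cos_le_one θ]

theorem abs_add_add_abs_sub {x N : ℝ} (hN : 1 ≤ N) :
    |(|x| / (2 * N) + x / 2)| + |(|x| / (2 * N) - x / 2)| = |x| := by
  have h0 : 0 ≤ |x| / (2 * N) := by positivity
  have h1 : |x| / (2 * N) ≤ |x| / 2 :=
    div_le_div_of_nonneg_left (abs_nonneg x) two_pos (by linarith)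
  generalize |x| / (2 * N) = t at *
  rcases abs_cases x with ⟨hx, _⟩ | ⟨hx, _⟩ <;> rw [hx] at h1 ⊢
  · rw [abs_of_nonneg (by linarith), abs_of_nonpos (by linarith)]
    ring
  · rw [abs_of_nonpos (by linarith), abs_of_nonneg (by linarith)]
    ring

theorem sum_abs_qpCoeff (θ : ℝ) :
    ∑ k : Fin 4, |qpCoeff θ k| = |Real.sin θ| + |Real.cos θ| := by
  have h := one_le_abs_sin_add_abs_cos θ
  have hs := abs_add_add_abs_sub (x := Real.sin θ) h
  have hc := abs_add_add_abs_sub (x := Real.cos θ) h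
  simp only [Fin.sum_univ_four, qpCoeff, Matrix.cons_val]
  linarith

theorem rotGate_conj_eq_sum {ι : Type*} [Fintype ι] [DecidableEq ι] {P : Matrix ι ι ℂ}
    (hP : Pᴴ = P) (θ : ℝ) (ρ : Matrix ι ι ℂ) :
    rotGate P θ * ρ * (rotGate P θ)ᴴ =
      ∑ k : Fin 4, (qpCoeff θ k : ℂ) •
        (rotGate P ((k : ℕ) * Real.pi / 2) * ρ * (rotGate P ((k : ℕ) * Real.pi / 2))ᴴ) := by
  have hN : (0 : ℝ) < |Real.sin θ| + |Real.cos θ| :=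
    one_pos.trans_le (one_le_abs_sin_add_abs_cos θ)
  have hsum : qpCoeff θ 0 + qpCoeff θ 1 + qpCoeff θ 2 + qpCoeff θ 3 = 1 := by
    simp only [qpCoeff, Matrix.cons_val]
    field_simp
    ring
  have hcos : qpCoeff θ 0 - qpCoeff θ 2 = Real.cos θ := by
    simp only [qpCoeff, Matrix.cons_val]
    ring
  have hsin : qpCoeff θ 1 - qpCoeff θ 3 = Real.sin θ := by
    simp only [qpCoeff, Matrix.cons_val]
    ring
  have hsum' : (qpCoeff θ 0 + qpCoeff θ 1 + qpCoeff θ 2 + qpCoeff θ 3 : ℂ) = 1 := by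
    exact_mod_cast hsum
  simp only [rotGate_conj hP, cos_nat_mul_pi_div_two, sin_nat_mul_pi_div_two, ← hcos, ← hsin]
  simp only [Fin.sum_univ_four, Matrix.cons_val]
  push_cast
  match_scalars
  · linear_combination (-1 / 2 : ℂ) * hsum'
  · linear_combination (-1 / 2 : ℂ) * hsum'
  · ring
  · ring

theorem abs_sin_add_abs_cos_le_of_decomposition {n : ℕ} {f : Fin n → Fin 4} (hf : f ≠ 0) (θ : ℝ)
    {ι : Type*} (s : Finset ι) (C : ι → Matrix (Fin n → Fin 2) (Fin n → Fin 2) ℂ) (a : ι → ℝ)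
    (hC : ∀ i ∈ s, IsClifford n (C i))
    (h : ∀ ρ : Matrix (Fin n → Fin 2) (Fin n → Fin 2) ℂ,
      ∑ i ∈ s, (a i : ℂ) • (C i * ρ * (C i)ᴴ) =
        rotGate (pauliWord n f) θ * ρ * (rotGate (pauliWord n f) θ)ᴴ) :
    |Real.sin θ| + |Real.cos θ| ≤ ∑ i ∈ s, |a i| := by
  obtain ⟨g, hg⟩ := exists_pauliWord_anticommute hf
  obtain ⟨b, w, hw⟩ := pauliWord_mul_mem n f g
  have hgw : g ≠ w := by
    rintro rfl
    have hfone : pauliWord n f = Complex.I ^ (b : ℕ) • (1 : Matrix _ _ ℂ) := by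
      rw [← Matrix.mul_one (pauliWord n f), ← pauliWord_mul_self n g, ← Matrix.mul_assoc, hw,
        Matrix.smul_mul]
    have hcomm : pauliWord n f * pauliWord n g = pauliWord n g * pauliWord n f := by
      rw [hfone]
      simp
    have hneg : pauliWord n f * pauliWord n g = -(pauliWord n f * pauliWord n g) :=
      hg.trans (by rw [hcomm])
    have hzero : pauliWord n f * pauliWord n g = 0 :=
      Matrix.ext fun x y => self_eq_neg.mp (congrFun (congrFun hneg x) y)
    have htrace := trace_pauliWord_mul n g g
    rw [hw] at hzero
    rw [(smul_eq_zero_iff_right (pow_ne_zero _ Complex.I_ne_zero)).mp hzero, Matrix.mul_zero,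
      Matrix.trace_zero, if_pos rfl] at htrace
    exact pow_ne_zero n two_ne_zero htrace.symm
  have hrot := h (pauliWord n g)
  rw [rotGate_conj_of_anticommute (pauliWord_conjTranspose n f) (pauliWord_mul_self n f) θ hg,
    hw] at hrot
  have hle (v : Fin n → Fin 4) :
      ‖(pauliWord n v * ((Real.cos θ : ℂ) • pauliWord n g -
        (Complex.I * Real.sin θ) • Complex.I ^ (b : ℕ) • pauliWord n w)).trace‖ ≤
      ∑ i ∈ s, |a i| * ‖(pauliWord n v * (C i * pauliWord n g * (C i)ᴴ)).trace‖ := by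
    rw [← hrot, Matrix.mul_sum, Matrix.trace_sum]
    refine (norm_sum_le _ _).trans_eq (Finset.sum_congr rfl fun i _ => ?_)
    rw [Matrix.mul_smul, Matrix.trace_smul, norm_smul, Complex.norm_real, Real.norm_eq_abs]
  have hg' := hle g
  have hw' := hle w
  simp only [Matrix.mul_sub, Matrix.mul_smul, Matrix.trace_sub, Matrix.trace_smul,
    trace_pauliWord_mul, if_neg hgw, if_neg hgw.symm, if_true, smul_zero, sub_zero, zero_sub,
    norm_neg, norm_smul, norm_mul, norm_pow, Complex.norm_I, one_pow, one_mul, Complex.norm_real,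
    Real.norm_eq_abs, Complex.norm_ofNat] at hg' hw'
  have hbound : ∑ i ∈ s, |a i| * ‖(pauliWord n g * (C i * pauliWord n g * (C i)ᴴ)).trace‖ +
      ∑ i ∈ s, |a i| * ‖(pauliWord n w * (C i * pauliWord n g * (C i)ᴴ)).trace‖ ≤
      (∑ i ∈ s, |a i|) * 2 ^ n := by
    rw [← Finset.sum_add_distrib, Finset.sum_mul]
    refine Finset.sum_le_sum fun i hi => ?_
    rw [← mul_add]
    exact mul_le_mul_of_nonneg_left
      (norm_trace_add_norm_trace_le hgw ((hC i hi).2 _ (pauliWord_mem n g))) (abs_nonneg _)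
  refine le_of_mul_le_mul_right ?_ (pow_pos two_pos n : (0 : ℝ) < 2 ^ n)
  linarith

/-- Lemma 2: the minimal ℓ1-norm over all real linear decompositions of the
rotation channel `R_P(θ)` into Clifford conjugation channels equals
`|sin θ| + |cos θ|`: (a) every such decomposition has ℓ1-norm at least
`|sin θ| + |cos θ|`, and (b) the bound is attained by the four Clifford
unitaries `R_P(kπ/2)`, `k = 0,1,2,3`, with coefficients `a_k(θ)`. -/
theorem optimal_clifford_decomposition_of_rotation
    (n : ℕ) (hn : 1 ≤ n) (f : Fin n → Fin 4) (hf : pauliWord n f ≠ 1) (θ : ℝ) :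
    (∀ (ι : Type) (s : Finset ι)
        (C : ι → Matrix (Fin n → Fin 2) (Fin n → Fin 2) ℂ) (a : ι → ℝ),
        (∀ i ∈ s, IsClifford n (C i)) →
        (∀ ρ : Matrix (Fin n → Fin 2) (Fin n → Fin 2) ℂ,
          ∑ i ∈ s, (a i : ℂ) • (C i * ρ * (C i)ᴴ) =
            rotGate (pauliWord n f) θ * ρ * (rotGate (pauliWord n f) θ)ᴴ) →
        |Real.sin θ| + |Real.cos θ| ≤ ∑ i ∈ s, |a i|) ∧
    (∀ k : Fin 4,
        IsClifford n (rotGate (pauliWord n f) ((k : ℕ) * Real.pi / 2))) ∧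
    (∀ ρ : Matrix (Fin n → Fin 2) (Fin n → Fin 2) ℂ,
        rotGate (pauliWord n f) θ * ρ * (rotGate (pauliWord n f) θ)ᴴ =
          ∑ k : Fin 4, (qpCoeff θ k : ℂ) •
            (rotGate (pauliWord n f) ((k : ℕ) * Real.pi / 2) * ρ *
              (rotGate (pauliWord n f) ((k : ℕ) * Real.pi / 2))ᴴ)) ∧
    (∑ k : Fin 4, |qpCoeff θ k| = |Real.sin θ| + |Real.cos θ|) := by
  have hf0 : f ≠ 0 := by
    rintro rfl
    exact hf (pauliWord_zero n)
  exact ⟨fun _ s C a => abs_sin_add_abs_cos_le_of_decomposition hf0 θ s C a,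
    isClifford_rotGate n f, rotGate_conj_eq_sum (pauliWord_conjTranspose n f) θ,
    sum_abs_qpCoeff θ⟩
end

section
/- (Observation 1, hardware-assisted coefficient learning for angle-independent dephasing.) Let γ ∈ ℝ with γ ≠ 1/2, let θ ∈ ℝ, and let b : {0,1,2,3} → ℝ. If for every ρ ∈ M₂(ℂ) one has D_γ(R_Z(θ) ρ R_Z(θ)†) = Σ_{k=0}^{3} b_k · D_γ(R_Z(kπ/2) ρ R_Z(kπ/2)†), then for every ρ ∈ M₂(ℂ), R_Z(θ) ρ R_Z(θ)† = Σ_{k=0}^{3} b_k · R_Z(kπ/2) ρ R_Z(kπ/2)†. That is, a Clifford decomposition learned under θ-independent dephasing noise remains valid in the noiseless limit. -/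
open Matrix

/-- The Pauli Z matrix. -/
noncomputable def Zg : Matrix (Fin 2) (Fin 2) ℂ := !![1, 0; 0, -1]

/-- The Z-rotation `R_Z(θ) = diag(e^{−iθ/2}, e^{iθ/2})`. -/
noncomputable def RZg (θ : ℝ) : Matrix (Fin 2) (Fin 2) ℂ :=
  !![Complex.exp (-(Complex.I * (θ : ℂ)) / 2), 0;
     0, Complex.exp (Complex.I * (θ : ℂ) / 2)]

/-- The dephasing channel `D_γ(σ) = (1−γ)σ + γ·ZσZ`. -/
noncomputable def Dgam (γ : ℝ) (σ : Matrix (Fin 2) (Fin 2) ℂ) :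
    Matrix (Fin 2) (Fin 2) ℂ :=
  ((1 - γ : ℝ) : ℂ) • σ + (γ : ℂ) • (Zg * σ * Zg)

lemma Dgam_apply (γ : ℝ) (σ : Matrix (Fin 2) (Fin 2) ℂ) (i j : Fin 2) :
    Dgam γ σ i j = (if i = j then 1 else 1 - 2 * (γ : ℂ)) * σ i j := by
  have hZ : Zg = diagonal ![1, -1] := by
    ext i j; fin_cases i <;> fin_cases j <;> simp [Zg]
  simp only [Dgam, hZ, Matrix.add_apply, Matrix.smul_apply, mul_diagonal, diagonal_mul]
  fin_cases i <;> fin_cases j <;> simp <;> ring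

lemma Dgam_injective {γ : ℝ} (hγ : γ ≠ 1 / 2) : Function.Injective (Dgam γ) := by
  have hne : (1 - 2 * (γ : ℂ)) ≠ 0 := by
    norm_cast
    exact fun h => hγ (by linarith)
  intro σ τ h
  ext i j
  have hij := congrFun₂ h i j
  rw [Dgam_apply, Dgam_apply] at hij
  refine mul_left_cancel₀ ?_ hij
  split_ifs
  exacts [one_ne_zero, hne]

lemma Dgam_sum_smul {ι : Type*} (γ : ℝ) (s : Finset ι) (c : ι → ℂ)
    (σ : ι → Matrix (Fin 2) (Fin 2) ℂ) :
    Dgam γ (∑ k ∈ s, c k • σ k) = ∑ k ∈ s, c k • Dgam γ (σ k) := by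
  ext i j
  simp only [Dgam_apply, Matrix.sum_apply, Matrix.smul_apply, smul_eq_mul, Finset.mul_sum]
  exact Finset.sum_congr rfl fun k _ => mul_left_comm _ _ _

/-- Observation 1 (hardware-assisted coefficient learning): a Clifford
decomposition learned under θ-independent dephasing noise remains valid in the
noiseless limit. -/
theorem dephasing_learned_decomposition_transfers
    (γ : ℝ) (hγ : γ ≠ 1 / 2) (θ : ℝ) (b : Fin 4 → ℝ)
    (h : ∀ ρ : Matrix (Fin 2) (Fin 2) ℂ,
      Dgam γ (RZg θ * ρ * (RZg θ)ᴴ) =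
        ∑ k : Fin 4, (b k : ℂ) •
          Dgam γ (RZg ((k : ℕ) * Real.pi / 2) * ρ *
            (RZg ((k : ℕ) * Real.pi / 2))ᴴ)) :
    ∀ ρ : Matrix (Fin 2) (Fin 2) ℂ,
      RZg θ * ρ * (RZg θ)ᴴ =
        ∑ k : Fin 4, (b k : ℂ) •
          (RZg ((k : ℕ) * Real.pi / 2) * ρ *
            (RZg ((k : ℕ) * Real.pi / 2))ᴴ) := by
  intro ρ
  apply Dgam_injective hγ
  rw [h ρ, Dgam_sum_smul]
end

section
/- (Lemma 1, Bennink et al. decomposition.) For every θ ∈ ℝ and every ρ ∈ M₂(ℂ), R_Z(θ) ρ R_Z(θ)† = ((1+cos θ−sin θ)/2)·ρ + ((1−cos θ−sin θ)/2)·ZρZ + sin θ·SρS†. Moreover, for θ ∈ [0, π/4] the ℓ1-norm of the three coefficients equals cos θ + sin θ: |(1+cos θ−sin θ)/2| + |(1−cos θ−sin θ)/2| + |sin θ| = cos θ + sin θ. -/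
open Matrix

/-- The phase gate `S = diag(1, i)`. -/
noncomputable def Sg : Matrix (Fin 2) (Fin 2) ℂ := !![1, 0; 0, Complex.I]

/-- Entrywise, conjugation by `R_Z(θ)` only rotates the phases of the off-diagonal entries. -/
theorem RZg_mul_mul_conjTranspose (θ : ℝ) (ρ : Matrix (Fin 2) (Fin 2) ℂ) :
    RZg θ * ρ * (RZg θ)ᴴ =
      !![ρ 0 0, Complex.exp (-((θ : ℂ) * Complex.I)) * ρ 0 1;
         Complex.exp ((θ : ℂ) * Complex.I) * ρ 1 0, ρ 1 1] := by
  have conj_neg : (starRingEnd ℂ) (Complex.exp (-(Complex.I * (θ : ℂ)) / 2)) =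
      Complex.exp (Complex.I * (θ : ℂ) / 2) := by
    rw [← Complex.exp_conj]
    simp [map_ofNat]
  have conj_pos : (starRingEnd ℂ) (Complex.exp (Complex.I * (θ : ℂ) / 2)) =
      Complex.exp (-(Complex.I * (θ : ℂ)) / 2) := by
    rw [← conj_neg, Complex.conj_conj]
  ext i j
  fin_cases i <;> fin_cases j <;>
    simp [RZg, Matrix.vecMul, dotProduct, Matrix.mul_apply, Fin.sum_univ_two, conj_neg,
      conj_pos] <;>
    rw [mul_right_comm, ← Complex.exp_add] <;> ring_nf <;> simp

theorem one_le_cos_add_sin {θ : ℝ} (hc : 0 ≤ Real.cos θ) (hs : 0 ≤ Real.sin θ) :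
    1 ≤ Real.cos θ + Real.sin θ := by
  nlinarith [Real.sin_sq_add_cos_sq θ, mul_nonneg hc hs]

/-- Lemma 1 (Bennink et al. decomposition): the Z-rotation channel decomposes
into the channels of `I`, `Z` and `S`, and for `θ ∈ [0, π/4]` the ℓ1-norm of
the coefficients equals `cos θ + sin θ`. -/
theorem bennink_decomposition (θ : ℝ) :
    (∀ ρ : Matrix (Fin 2) (Fin 2) ℂ,
      RZg θ * ρ * (RZg θ)ᴴ =
        (((1 + Real.cos θ - Real.sin θ) / 2 : ℝ) : ℂ) • ρ +
        (((1 - Real.cos θ - Real.sin θ) / 2 : ℝ) : ℂ) • (Zg * ρ * Zg) +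
        ((Real.sin θ : ℝ) : ℂ) • (Sg * ρ * Sgᴴ)) ∧
    (θ ∈ Set.Icc (0 : ℝ) (Real.pi / 4) →
      |(1 + Real.cos θ - Real.sin θ) / 2| + |(1 - Real.cos θ - Real.sin θ) / 2| +
          |Real.sin θ| = Real.cos θ + Real.sin θ) := by
  constructor
  · intro ρ
    rw [RZg_mul_mul_conjTranspose]
    ext i j
    fin_cases i <;> fin_cases j <;>
      simp [Zg, Sg, Matrix.vecMul, dotProduct, Matrix.mul_apply, Fin.sum_univ_two, ← neg_mul,
        Complex.exp_mul_I] <;>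
      ring_nf <;> simp
  · rintro ⟨h0, h1⟩
    have hs : 0 ≤ Real.sin θ := Real.sin_nonneg_of_nonneg_of_le_pi h0 (by linarith [Real.pi_pos])
    have hc : 0 ≤ Real.cos θ :=
      Real.cos_nonneg_of_neg_pi_div_two_le_of_le (by linarith [Real.pi_pos])
        (by linarith [Real.pi_pos])
    rw [abs_of_nonneg (by linarith [Real.sin_le_one θ]),
      abs_of_nonpos (by linarith [one_le_cos_add_sin hc hs]), abs_of_nonneg hs]
    ring
end

section
/- (Robustness of magic of the rotated plus state.) Let θ ∈ ℝ and let ρ(θ) = R_Z(θ) |+⟩⟨+| R_Z(θ)† ∈ M₂(ℂ), where |+⟩⟨+| = (I + X)/2. Consider the six single-qubit pure stabilizer states as density matrices: S₁ = (I+X)/2, S₂ = (I−X)/2, S₃ = (I+Y)/2, S₄ = (I−Y)/2, S₅ = (I+Z)/2, S₆ = (I−Z)/2. Then: (a) for every q ∈ ℝ⁶ with Σ_{j=1}^{6} q_j S_j = ρ(θ), one has Σ_{j=1}^{6} |q_j| ≥ |cos θ| + |sin θ|; and (b) there exists q ∈ ℝ⁶ with Σ_{j=1}^{6} q_j S_j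 = ρ(θ) and Σ_{j=1}^{6} |q_j| = |cos θ| + |sin θ|. Hence the robustness of magic of ρ(θ), the minimal ℓ1-norm over real affine decompositions into single-qubit stabilizer states, equals |cos θ| + |sin θ|. -/
open Matrix

/-- The Pauli X matrix. -/
noncomputable def Xg : Matrix (Fin 2) (Fin 2) ℂ := !![0, 1; 1, 0]

/-- The Pauli Y matrix. -/
noncomputable def Yg : Matrix (Fin 2) (Fin 2) ℂ := !![0, -Complex.I; Complex.I, 0]

/-- The six single-qubit pure stabilizer states
`(I ± X)/2, (I ± Y)/2, (I ± Z)/2` as density matrices. -/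
noncomputable def stabState : Fin 6 → Matrix (Fin 2) (Fin 2) ℂ :=
  ![(1 / 2 : ℂ) • ((1 : Matrix (Fin 2) (Fin 2) ℂ) + Xg),
    (1 / 2 : ℂ) • ((1 : Matrix (Fin 2) (Fin 2) ℂ) - Xg),
    (1 / 2 : ℂ) • ((1 : Matrix (Fin 2) (Fin 2) ℂ) + Yg),
    (1 / 2 : ℂ) • ((1 : Matrix (Fin 2) (Fin 2) ℂ) - Yg),
    (1 / 2 : ℂ) • ((1 : Matrix (Fin 2) (Fin 2) ℂ) + Zg),
    (1 / 2 : ℂ) • ((1 : Matrix (Fin 2) (Fin 2) ℂ) - Zg)]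

/-- The rotated plus state `ρ(θ) = R_Z(θ) |+⟩⟨+| R_Z(θ)†`. -/
noncomputable def rotatedPlus (θ : ℝ) : Matrix (Fin 2) (Fin 2) ℂ :=
  RZg θ * ((1 / 2 : ℂ) • ((1 : Matrix (Fin 2) (Fin 2) ℂ) + Xg)) * (RZg θ)ᴴ

/-- The Bloch form of the rotated plus state. -/
lemma rotatedPlus_eq (θ : ℝ) :
    rotatedPlus θ =
      (1 / 2 : ℂ) • !![1, Real.cos θ - Complex.I * Real.sin θ;
        Real.cos θ + Complex.I * Real.sin θ, 1] := by
  have hneg : Complex.exp (-(Complex.I * (θ : ℂ)) / 2) * Complex.exp (-(Complex.I * (θ : ℂ)) / 2) =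
      Real.cos θ - Complex.I * Real.sin θ := by
    rw [← Complex.exp_add, show -(Complex.I * (θ : ℂ)) / 2 + -(Complex.I * (θ : ℂ)) / 2 =
      (-(θ : ℂ)) * Complex.I by ring, Complex.exp_mul_I]
    simp
    ring
  have hpos : Complex.exp (Complex.I * (θ : ℂ) / 2) * Complex.exp (Complex.I * (θ : ℂ) / 2) =
      Real.cos θ + Complex.I * Real.sin θ := by
    rw [← Complex.exp_add, show Complex.I * (θ : ℂ) / 2 + Complex.I * (θ : ℂ) / 2 =
      (θ : ℂ) * Complex.I by ring, Complex.exp_mul_I]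
    simp
    ring
  have hone : Complex.exp (-(Complex.I * (θ : ℂ)) / 2) * Complex.exp (Complex.I * (θ : ℂ) / 2) =
      1 := by
    rw [← Complex.exp_add, ← Complex.exp_zero]
    congr 1
    ring
  have hconj : (starRingEnd ℂ) (Complex.exp (-(Complex.I * (θ : ℂ)) / 2)) =
      Complex.exp (Complex.I * (θ : ℂ) / 2) := by
    rw [← Complex.exp_conj]
    simp [map_ofNat]
  have hconj' : (starRingEnd ℂ) (Complex.exp (Complex.I * (θ : ℂ) / 2)) =
      Complex.exp (-(Complex.I * (θ : ℂ)) / 2) := by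
    rw [← hconj, Complex.conj_conj]
  rw [← hneg, ← hpos, rotatedPlus, RZg, Xg, Matrix.one_fin_two]
  generalize Complex.exp (-(Complex.I * (θ : ℂ)) / 2) = a at *
  generalize Complex.exp (Complex.I * (θ : ℂ) / 2) = b at *
  ext i j
  fin_cases i <;> fin_cases j <;>
    simp [Matrix.mul_apply, Fin.sum_univ_two, hconj, hconj'] <;>
    first
    | ring1
    | linear_combination (1 / 2 : ℂ) * hone

/-- A real combination of stabilizer states equals `ρ(θ)` iff its trace and Bloch coordinates
agree with those of `ρ(θ)`. -/
lemma sum_smul_stabState_eq_rotatedPlus_iff (θ : ℝ) (q : Fin 6 → ℝ) :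
    ∑ j : Fin 6, (q j : ℂ) • stabState j = rotatedPlus θ ↔
      q 0 + q 1 + q 2 + q 3 + q 4 + q 5 = 1 ∧ q 0 - q 1 = Real.cos θ ∧
        q 2 - q 3 = Real.sin θ ∧ q 4 = q 5 := by
  have hsum : ∑ j : Fin 6, (q j : ℂ) • stabState j =
      (1 / 2 : ℂ) • !![((q 0 + q 1 + q 2 + q 3 + q 4 + q 5 + (q 4 - q 5) : ℝ) : ℂ),
        ((q 0 - q 1 : ℝ) : ℂ) - Complex.I * ((q 2 - q 3 : ℝ) : ℂ);
        ((q 0 - q 1 : ℝ) : ℂ) + Complex.I * ((q 2 - q 3 : ℝ) : ℂ),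
        ((q 0 + q 1 + q 2 + q 3 + q 4 + q 5 - (q 4 - q 5) : ℝ) : ℂ)] := by
    ext i j
    fin_cases i <;> fin_cases j <;>
      simp [Fin.sum_univ_six, stabState, Xg, Yg, Zg] <;> ring
  rw [hsum, rotatedPlus_eq]
  constructor
  · intro h
    have h := smul_right_injective _ (by norm_num : (1 / 2 : ℂ) ≠ 0) h
    have h00 := congrArg Complex.re (congrFun (congrFun h 0) 0)
    have h10 := congrFun (congrFun h 1) 0
    have h11 := congrArg Complex.re (congrFun (congrFun h 1) 1)
    have hre := congrArg Complex.re h10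
    have him := congrArg Complex.im h10
    simp only [Matrix.of_apply, Matrix.cons_val', Matrix.cons_val_zero, Matrix.cons_val_one,
      Matrix.cons_val_fin_one, Complex.ofReal_re, Complex.ofReal_im, Complex.add_re,
      Complex.add_im, Complex.mul_re, Complex.mul_im, Complex.I_re, Complex.I_im,
      Complex.one_re] at h00 h11 hre him
    refine ⟨?_, ?_, ?_, ?_⟩ <;> linarith
  · rintro ⟨h1, hc, hs, hz⟩
    rw [h1, hc, hs, hz]
    simp

/-- Robustness of magic of the rotated plus state: (a) every real decomposition
of `ρ(θ)` into the six single-qubit stabilizer states has ℓ1-norm at least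
`|cos θ| + |sin θ|`, and (b) this value is attained; hence the robustness of
magic of `ρ(θ)` equals `|cos θ| + |sin θ|`. -/
theorem robustness_of_magic_rotated_plus (θ : ℝ) :
    (∀ q : Fin 6 → ℝ,
      (∑ j : Fin 6, (q j : ℂ) • stabState j = rotatedPlus θ) →
      |Real.cos θ| + |Real.sin θ| ≤ ∑ j : Fin 6, |q j|) ∧
    (∃ q : Fin 6 → ℝ,
      (∑ j : Fin 6, (q j : ℂ) • stabState j = rotatedPlus θ) ∧
      ∑ j : Fin 6, |q j| = |Real.cos θ| + |Real.sin θ|) := by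
  simp only [sum_smul_stabState_eq_rotatedPlus_iff]
  constructor
  · rintro q ⟨-, hc, hs, -⟩
    rw [← hc, ← hs, Fin.sum_univ_six]
    linarith [abs_sub (q 0) (q 1), abs_sub (q 2) (q 3), abs_nonneg (q 4), abs_nonneg (q 5)]
  · set C := Real.cos θ
    set S := Real.sin θ
    have hC1 : |C| ≤ 1 := Real.abs_cos_le_one θ
    have hS1 : |S| ≤ 1 := Real.abs_sin_le_one θ
    have hCS : 1 ≤ |C| + |S| := by
      nlinarith [Real.sin_sq_add_cos_sq θ, sq_abs C, sq_abs S, abs_nonneg C, abs_nonneg S]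
    have abs_pair : ∀ a b : ℝ, 0 ≤ a → a ≤ |b| → |(a + b) / 2| + |(a - b) / 2| = |b| := by
      intro a b ha hab
      rcases abs_cases b with ⟨hb, _⟩ | ⟨hb, _⟩ <;> rw [hb] at hab ⊢
      · rw [abs_of_nonneg (by linarith), abs_of_nonpos (by linarith)]
        ring
      · rw [abs_of_nonpos (by linarith), abs_of_nonneg (by linarith)]
        ring
    refine ⟨![(|C| + C) / 2, (|C| - C) / 2, (1 - |C| + S) / 2, (1 - |C| - S) / 2, 0, 0],
      ⟨?_, ?_, ?_, ?_⟩, ?_⟩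
    · simp; ring
    · simp; ring
    · simp; ring
    · simp
    · have h₁ := abs_pair |C| C (abs_nonneg C) le_rfl
      have h₂ := abs_pair (1 - |C|) S (by linarith) (by linarith)
      simp only [Fin.sum_univ_six, Matrix.cons_val, abs_zero]
      linarith
end
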